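/- arXiv:1401.1005 — 2 statements merged into one kernel-verified Lean document; each statement's English description precedes it below -/
import Mathlib

section
/- Let f : Λ → Λ be a continuous map on a compact metric space, and (F_n) a sub-additive sequence of non-negative continuous functions on Λ. Suppose that for every ergodic f-invariant Borel probability measure μ, lim_{m→∞} (1/m) ∫ F_m dμ = 0. Suppose also that the convergence-to-zero fails to be uniform, i.e. there exist ε₀ > 0, n_k ≥ k and points x_{n_k} ∈ Λ with (1/n_k) F_{n_k}(x_{n_k}) ≥ ε₀. Then any weak* limit μ of the empirical measures μ_{n_k} = (1/n_k) ∑_{i=0}^{n_k−1} δ_{f^i(x_{n_k})} is an f-invariant measure satisfying lim_{m→∞} ∫ (1/m) F_m dμ ≥ ε₀ > 0, contradicting the ergodic decomposition; hence (1/n) F_n → 0 uniformly on Λ. -/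
open MeasureTheory

open Filter Topology Set Finset
open scoped ENNReal BoundedContinuousFunction

section Pointwise

variable {X : Type*} {f : X → X} {F : ℕ → X → ℝ}

/-- A nonnegative subadditive cocycle of bounded functions is dominated, up to an additive constant,
by the Birkhoff sums of any of its members. -/
theorem mul_le_birkhoffSum_add_of_subadditive (hFnn : ∀ n x, 0 ≤ F n x)
    (hsub : ∀ m n x, F (m + n) x ≤ F n x + F m (f^[n] x))
    (hbdd : ∀ n, ∃ C, ∀ x, F n x ≤ C) {m : ℕ} (hm : 1 ≤ m) :
    ∃ C, ∀ n x, m * F n x ≤ birkhoffSum f (F m) n x + C := by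
  choose c hc using hbdd
  obtain ⟨M, hM⟩ : ∃ M, ∀ j ≤ m, ∀ x, F j x ≤ M := by
    refine ⟨∑ j ∈ range (m + 1), |c j|, fun j hj x => ?_⟩
    exact ((hc j x).trans (le_abs_self _)).trans
      (single_le_sum (f := fun j => |c j|) (fun i _ => abs_nonneg (c i)) (by simp; omega))
  have birkhoff_nonneg : ∀ n x, 0 ≤ birkhoffSum f (F m) n x :=
    fun n x => sum_nonneg fun i _ => hFnn _ _
  have average_le : ∀ n x, ∑ j ∈ range m, F n (f^[j] x) ≤ birkhoffSum f (F m) n x + m * M := by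
    intro n
    induction n using Nat.strong_induction_on with
    | _ n ih =>
      intro x
      rcases lt_or_ge n m with hn | hn
      · have : ∑ j ∈ range m, F n (f^[j] x) ≤ m * M := by
          simpa using sum_le_card_nsmul (range m) (fun j => F n (f^[j] x)) M
            fun j _ => hM n hn.le _
        linarith [birkhoff_nonneg n x]
      · obtain ⟨k, rfl⟩ := Nat.exists_eq_add_of_le hn
        have h1 := ih k (by omega) (f^[m] x)
        have h2 : ∑ j ∈ range m, F (m + k) (f^[j] x) ≤
            birkhoffSum f (F m) m x + ∑ j ∈ range m, F k (f^[j] (f^[m] x)) := by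
          rw [birkhoffSum, ← sum_add_distrib]
          refine sum_le_sum fun j _ => ?_
          have := hsub k m (f^[j] x)
          rwa [add_comm k m, ← Function.iterate_add_apply, add_comm m j,
            Function.iterate_add_apply] at this
        rw [birkhoffSum_add]
        linarith
  refine ⟨3 * (m * M), fun n x => ?_⟩
  have hM0 : 0 ≤ M := (hFnn 0 x).trans (hM 0 (Nat.zero_le _) x)
  have hmM : 0 ≤ m * M := by positivity
  rcases lt_or_ge n m with hn | hn
  · have : m * F n x ≤ m * M := by gcongr; exact hM n hn.le x
    linarith [birkhoff_nonneg n x]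
  · obtain ⟨k, rfl⟩ := Nat.exists_eq_add_of_le' hn
    have h1 : ∀ j ∈ range m, F (k + m) x ≤ F k (f^[j] x) + 2 * M := by
      intro j hj
      have hj' : j < m := by simpa using hj
      have e : k + m = ((m - j) + k) + j := by omega
      have a1 := hsub ((m - j) + k) j x
      have a2 := hsub (m - j) k (f^[j] x)
      rw [e]
      linarith [hM j hj'.le x, hM (m - j) (by omega) (f^[k] (f^[j] x))]
    have h2 := sum_le_sum h1
    simp only [sum_const, card_range, nsmul_eq_mul, sum_add_distrib] at h2
    have h3 := average_le k x
    have h4 : birkhoffSum f (F m) k x ≤ birkhoffSum f (F m) (k + m) x := by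
      rw [birkhoffSum_add]
      linarith [birkhoff_nonneg m (f^[k] x)]
    linarith

end Pointwise

section Invariant

variable {X : Type*} [TopologicalSpace X] [CompactSpace X] [MeasurableSpace X]
  [BorelSpace X]

theorem continuous_integral_probabilityMeasure (g : C(X, ℝ)) :
    Continuous fun ν : ProbabilityMeasure X => ∫ x, g x ∂(ν : Measure X) := by
  rw [continuous_iff_continuousAt]
  intro ν
  exact (ProbabilityMeasure.tendsto_iff_forall_integral_tendsto.1 tendsto_id)
    (BoundedContinuousFunction.mkOfCompact g)

theorem ContinuousMap.integrable_of_compactSpace (μ : Measure X) [IsFiniteMeasure μ]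
    (g : C(X, ℝ)) : Integrable g μ :=
  (BoundedContinuousFunction.mkOfCompact g).integrable μ

theorem integral_smul_add_smul_measure (μ ν : Measure X) [IsFiniteMeasure μ] [IsFiniteMeasure ν]
    {a b : ℝ≥0∞} (ha : a ≠ ∞) (hb : b ≠ ∞) (g : C(X, ℝ)) :
    ∫ x, g x ∂(a • μ + b • ν) = a.toReal * ∫ x, g x ∂μ + b.toReal * ∫ x, g x ∂ν := by
  rw [integral_add_measure ((g.integrable_of_compactSpace μ).smul_measure ha)
    ((g.integrable_of_compactSpace ν).smul_measure hb)]
  simp [integral_smul_measure]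

variable [HasOuterApproxClosed X]

omit [CompactSpace X] in
theorem measure_eq_of_forall_integral_continuousMap_eq {μ ν : Measure X} [IsFiniteMeasure μ]
    [IsFiniteMeasure ν] (h : ∀ g : C(X, ℝ), ∫ x, g x ∂μ = ∫ x, g x ∂ν) : μ = ν :=
  ext_of_forall_integral_eq_of_IsFiniteMeasure fun g => h g.toContinuousMap

omit [CompactSpace X] in
theorem measurePreserving_iff_forall_integral_comp_eq (f : C(X, X)) (μ : Measure X)
    [IsProbabilityMeasure μ] :
    MeasurePreserving f μ μ ↔ ∀ g : C(X, ℝ), ∫ x, g (f x) ∂μ = ∫ x, g x ∂μ := by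
  have hf := f.continuous.measurable
  have hmap : ∀ g : C(X, ℝ), ∫ x, g x ∂(μ.map f) = ∫ x, g (f x) ∂μ := fun g =>
    integral_map hf.aemeasurable (g.continuous.measurable.aestronglyMeasurable)
  refine ⟨fun h g => ?_, fun h => ⟨hf, ?_⟩⟩
  · rw [← hmap, h.map_eq]
  · have := Measure.isProbabilityMeasure_map (μ := μ) hf.aemeasurable
    exact measure_eq_of_forall_integral_continuousMap_eq fun g => (hmap g).trans (h g)

theorem isClosed_setOf_measurePreserving (f : C(X, X)) :
    IsClosed {ν : ProbabilityMeasure X | MeasurePreserving f (ν : Measure X) ν} := by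
  simp only [measurePreserving_iff_forall_integral_comp_eq, ofPred_forall]
  exact isClosed_iInter fun g => isClosed_eq
    (continuous_integral_probabilityMeasure (g.comp f)) (continuous_integral_probabilityMeasure g)

/-- Bauer's maximum principle for invariant measures: an upper semicontinuous functional that is
affine on invariant probability measures is maximized by an ergodic measure. -/
theorem exists_ergodic_le_of_upperSemicontinuous [T2Space X] (f : C(X, X)) (Φ : Measure X → ℝ)
    (husc : UpperSemicontinuous fun ν : ProbabilityMeasure X => Φ ν)
    (haff : ∀ (μ ν : Measure X) [IsProbabilityMeasure μ] [IsProbabilityMeasure ν] (a b : ℝ≥0∞),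
      MeasurePreserving f μ μ → MeasurePreserving f ν ν → a + b = 1 →
      Φ (a • μ + b • ν) = a.toReal * Φ μ + b.toReal * Φ ν)
    (ν : ProbabilityMeasure X) (hν : MeasurePreserving f (ν : Measure X) ν) :
    ∃ μ : ProbabilityMeasure X, Ergodic f (μ : Measure X) ∧ Φ ν ≤ Φ μ := by
  set I : Set (ProbabilityMeasure X) := {ν | MeasurePreserving f (ν : Measure X) ν}
  have hIc : IsCompact I := (isClosed_setOf_measurePreserving f).isCompact
  obtain ⟨ρ, hρ, hmax⟩ := (husc.upperSemicontinuousOn I).exists_isMaxOn ⟨ν, hν⟩ hIc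
  set S : Set (ProbabilityMeasure X) := I ∩ (fun ν : ProbabilityMeasure X => Φ ν) ⁻¹' Ici (Φ ρ)
  have hSc : IsCompact S := (husc.upperSemicontinuousOn I).isCompact_inter_preimage_Ici hIc _
  let e : ProbabilityMeasure X → C(X, ℝ) → ℝ := fun ν g => ∫ x, g x ∂(ν : Measure X)
  have he : Continuous e := continuous_pi fun g => continuous_integral_probabilityMeasure g
  obtain ⟨_, hext⟩ := (hSc.image he).extremePoints_nonempty
    ⟨_, mem_image_of_mem e ⟨hρ, le_refl (Φ ρ)⟩⟩
  obtain ⟨μ, hμ, rfl⟩ := extremePoints_subset hext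
  refine ⟨μ, Ergodic.of_mem_extremePoints ⟨⟨hμ.1, inferInstance⟩, ?_⟩,
    (hmax hν : Φ ν ≤ Φ ρ).trans hμ.2⟩
  rintro μ₁ ⟨h₁, hp₁⟩ μ₂ ⟨h₂, hp₂⟩ ⟨a, b, ha, hb, hab, hμeq⟩
  have ha' : a ≠ ∞ := ne_top_of_le_ne_top ENNReal.one_ne_top (hab ▸ le_self_add)
  have hb' : b ≠ ∞ := ne_top_of_le_ne_top ENNReal.one_ne_top (hab ▸ le_add_self)
  have har : 0 < a.toReal := ENNReal.toReal_pos ha.ne' ha'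
  have hbr : 0 < b.toReal := ENNReal.toReal_pos hb.ne' hb'
  have habr : a.toReal + b.toReal = 1 := by
    rw [← ENNReal.toReal_add ha' hb', hab, ENNReal.toReal_one]
  have hΦ := haff μ₁ μ₂ a b h₁ h₂ hab
  rw [hμeq] at hΦ
  let ν₁ : ProbabilityMeasure X := ⟨μ₁, hp₁⟩
  let ν₂ : ProbabilityMeasure X := ⟨μ₂, hp₂⟩
  have m₁ : Φ μ₁ ≤ Φ ρ := hmax (show ν₁ ∈ I from h₁)
  have m₂ : Φ μ₂ ≤ Φ ρ := hmax (show ν₂ ∈ I from h₂)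
  have hμΦ : Φ ρ ≤ Φ μ := hμ.2
  have hge : ∀ {r t u v : ℝ}, 0 < r → 0 < t → r + t = 1 → v ≤ Φ ρ →
      Φ ρ ≤ r * u + t * v → Φ ρ ≤ u := by
    intro r t u v hr ht hrt hv h
    have h1 : t * v ≤ t * Φ ρ := by gcongr
    obtain rfl : t = 1 - r := by linarith
    exact le_of_mul_le_mul_left (by linarith) hr
  have s₁ : ν₁ ∈ S := ⟨h₁, show Φ ρ ≤ Φ μ₁ from hge har hbr habr m₂ (hμΦ.trans_eq hΦ)⟩
  have s₂ : ν₂ ∈ S := ⟨h₂, show Φ ρ ≤ Φ μ₂ from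
    hge hbr har (by rwa [add_comm]) m₁ (by rwa [add_comm, ← hΦ])⟩
  have hseg : e μ ∈ openSegment ℝ (e ν₁) (e ν₂) := by
    refine ⟨a.toReal, b.toReal, har, hbr, habr, ?_⟩
    ext g
    simpa [e, ν₁, ν₂, hμeq] using (integral_smul_add_smul_measure μ₁ μ₂ ha' hb' g).symm
  have heq : e ν₁ = e μ := hext.2 (mem_image_of_mem e s₁) (mem_image_of_mem e s₂) hseg
  exact measure_eq_of_forall_integral_continuousMap_eq fun g => congrFun heq g

end Invariant

section Empirical

variable {X : Type*} [MeasurableSpace X]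

/-- The empirical measure of the orbit segment of length `n + 1` starting at `x`. -/
noncomputable def empiricalMeasure (f : X → X) (n : ℕ) (x : X) : ProbabilityMeasure X :=
  ⟨((n + 1 : ℕ) : ℝ≥0∞)⁻¹ • ∑ i ∈ range (n + 1), Measure.dirac (f^[i] x), ⟨by
    simp only [Measure.smul_apply, Measure.finsetSum_apply, measure_univ, sum_const, card_range,
      smul_eq_mul, nsmul_eq_mul, mul_one]
    exact ENNReal.inv_mul_cancel (by simp) (ENNReal.natCast_ne_top _)⟩⟩

variable [TopologicalSpace X] [CompactSpace X] [BorelSpace X]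

theorem integral_empiricalMeasure (f : X → X) (n : ℕ) (x : X) (g : C(X, ℝ)) :
    ∫ y, g y ∂(empiricalMeasure f n x : Measure X) = birkhoffAverage ℝ f g (n + 1) x := by
  have hg := g.continuous.measurable.stronglyMeasurable
  rw [empiricalMeasure, ProbabilityMeasure.coe_mk, integral_smul_measure,
    integral_finsetSum_measure fun i _ => g.integrable_of_compactSpace _]
  simp only [integral_dirac' _ _ hg, birkhoffAverage, birkhoffSum, ENNReal.toReal_inv,
    ENNReal.toReal_natCast]

variable [HasOuterApproxClosed X]

theorem measurePreserving_of_tendsto_empiricalMeasure (f : C(X, X)) {l : Filter ℕ} [l.NeBot]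
    (hl : l ≤ atTop) (x : ℕ → X) {ν : ProbabilityMeasure X}
    (hν : Tendsto (fun n => empiricalMeasure f n (x n)) l (𝓝 ν)) :
    MeasurePreserving f (ν : Measure X) ν := by
  refine (measurePreserving_iff_forall_integral_comp_eq f _).2 fun g => ?_
  have h1 := ((continuous_integral_probabilityMeasure (g.comp f)).tendsto ν).comp hν
  have h2 := ((continuous_integral_probabilityMeasure g).tendsto ν).comp hν
  have h3 := h1.sub h2
  simp only [Function.comp_def, integral_empiricalMeasure] at h3
  have h4 : Tendsto (fun n : ℕ => 2 * ‖g‖ * (1 / ((n : ℝ) + 1))) l (𝓝 0) := by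
    simpa using (tendsto_one_div_add_atTop_nhds_zero_nat.mono_left hl).const_mul (2 * ‖g‖)
  refine sub_eq_zero.1 (tendsto_nhds_unique h3 (squeeze_zero_norm (fun n => ?_) h4))
  · have e : birkhoffAverage ℝ f (g.comp f) (n + 1) (x n) =
        birkhoffAverage ℝ f g (n + 1) (f (x n)) := by
      simp only [birkhoffAverage, birkhoffSum, ContinuousMap.comp_apply,
        ← Function.iterate_succ_apply, ← Function.iterate_succ_apply']
    rw [e, birkhoffAverage_apply_sub_birkhoffAverage, norm_smul, mul_comm]
    have : ‖g (f^[n + 1] (x n)) - g (x n)‖ ≤ 2 * ‖g‖ := by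
      linarith [norm_sub_le (g (f^[n + 1] (x n))) (g (x n)), g.norm_coe_le_norm (x n),
        g.norm_coe_le_norm (f^[n + 1] (x n))]
    have e2 : ‖(((n + 1 : ℕ) : ℝ))⁻¹‖ = 1 / ((n : ℝ) + 1) := by
      rw [Real.norm_of_nonneg (by positivity)]; push_cast; rw [one_div]
    rw [e2]
    gcongr

end Empirical

section Growth

variable {X : Type*} [TopologicalSpace X] [CompactSpace X] [MeasurableSpace X]
  [BorelSpace X]

/-- The infimum over `n ≥ 1` of `(1 / n) ∫ F n ∂μ`. -/
noncomputable def subadditiveGrowth (F : ℕ → X → ℝ) (μ : Measure X) : ℝ :=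
  sInf ((fun n : ℕ => (∫ x, F n x ∂μ) / n) '' Ici 1)

theorem tendsto_subadditiveGrowth {f : X → X} {F : ℕ → X → ℝ} (hFc : ∀ n, Continuous (F n))
    (hFnn : ∀ n x, 0 ≤ F n x) (hsub : ∀ m n x, F (m + n) x ≤ F n x + F m (f^[n] x))
    {μ : Measure X} [IsFiniteMeasure μ] (hμ : MeasurePreserving f μ μ) :
    Tendsto (fun n : ℕ => (∫ x, F n x ∂μ) / n) atTop (𝓝 (subadditiveGrowth F μ)) := by
  have hint : ∀ n, Integrable (F n) μ := fun n =>
    ContinuousMap.integrable_of_compactSpace μ ⟨F n, hFc n⟩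
  have hs : Subadditive fun n => ∫ x, F n x ∂μ := by
    intro m n
    have hn := hμ.iterate n
    have hcomp : Integrable (fun x => F m (f^[n] x)) μ := hn.integrable_comp_of_integrable (hint m)
    have heq : ∫ x, F m (f^[n] x) ∂μ = ∫ x, F m x ∂μ := by
      conv_rhs => rw [← hn.map_eq]
      exact (integral_map hn.aemeasurable (hFc m).measurable.aestronglyMeasurable).symm
    calc ∫ x, F (m + n) x ∂μ ≤ ∫ x, (F n x + F m (f^[n] x)) ∂μ :=
          integral_mono (hint _) ((hint n).add hcomp) (hsub m n)
      _ = ∫ x, F m x ∂μ + ∫ x, F n x ∂μ := by rw [integral_add (hint n) hcomp, heq, add_comm]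
  have hlim := hs.tendsto_lim ⟨0, by
    rintro _ ⟨n, rfl⟩
    exact div_nonneg (integral_nonneg (hFnn n)) n.cast_nonneg⟩
  rwa [Subadditive.lim] at hlim

theorem upperSemicontinuous_subadditiveGrowth {F : ℕ → X → ℝ} (hFc : ∀ n, Continuous (F n))
    (hFnn : ∀ n x, 0 ≤ F n x) :
    UpperSemicontinuous fun ν : ProbabilityMeasure X => subadditiveGrowth F ν := by
  simp only [subadditiveGrowth, sInf_image']
  refine upperSemicontinuous_ciInf (fun ν => ⟨0, ?_⟩) fun n => ?_
  · rintro _ ⟨n, rfl⟩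
    exact div_nonneg (integral_nonneg (hFnn n)) n.1.cast_nonneg
  · exact ((continuous_integral_probabilityMeasure ⟨F n, hFc n⟩).div_const _).upperSemicontinuous

end Growth

/-- for a sub-additive sequence of non-negative continuous functions F_n
on a compact metric space with continuous f, if (1/m)∫F_m dμ → 0 for every ergodic
invariant probability measure μ, then (1/n)F_n → 0 uniformly on Λ. -/
theorem subadditive_uniform_convergence {Λ : Type*} [MetricSpace Λ] [CompactSpace Λ]
    [MeasurableSpace Λ] [BorelSpace Λ]
    (f : Λ → Λ) (hf : Continuous f)
    (F : ℕ → Λ → ℝ) (hFc : ∀ n, Continuous (F n)) (hFnn : ∀ n x, 0 ≤ F n x)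
    (hsub : ∀ m n : ℕ, 1 ≤ m → 1 ≤ n → ∀ x : Λ, F (m + n) x ≤ F n x + F m (f^[n] x))
    (herg : ∀ μ : Measure Λ, IsProbabilityMeasure μ → Ergodic f μ →
      Filter.Tendsto (fun m : ℕ => (1 / (m : ℝ)) * ∫ x, F m x ∂μ)
        Filter.atTop (nhds 0)) :
    TendstoUniformly (fun n : ℕ => fun x : Λ => (1 / (n : ℝ)) * F n x)
      (fun _ : Λ => (0 : ℝ)) Filter.atTop := by
  have hsub' : ∀ m n x, F (m + n) x ≤ F n x + F m (f^[n] x) := by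
    intro m n x
    rcases Nat.eq_zero_or_pos m with rfl | hm
    · simpa using hFnn 0 (f^[n] x)
    rcases Nat.eq_zero_or_pos n with rfl | hn
    · simpa using hFnn 0 x
    exact hsub m n hm hn x
  rw [Metric.tendstoUniformly_iff]
  intro ε hε
  by_contra hnot
  have hfreq : ∃ᶠ n : ℕ in atTop, ∃ x, ε * ((n : ℝ) + 1) ≤ F (n + 1) x := by
    refine fun hev => hnot ?_
    obtain ⟨N, hN⟩ := eventually_atTop.1 hev
    filter_upwards [eventually_ge_atTop (N + 1)] with n hn x
    obtain ⟨k, rfl⟩ := Nat.exists_eq_add_of_le' (le_of_add_le_right hn)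
    have hk := hN k (by omega)
    push Not at hk
    have hk' : (0 : ℝ) < ((k + 1 : ℕ) : ℝ) := by positivity
    rw [dist_comm, Real.dist_0_eq_abs, abs_of_nonneg (mul_nonneg (by positivity) (hFnn _ x)),
      one_div_mul_eq_div, div_lt_iff₀ hk']
    exact_mod_cast hk x
  obtain ⟨n₀, x₀, -⟩ := hfreq.exists
  have : Nonempty Λ := ⟨x₀⟩
  obtain ⟨x, hx⟩ : ∃ x : ℕ → Λ, ∃ᶠ n : ℕ in atTop, ε * ((n : ℝ) + 1) ≤ F (n + 1) (x n) := by
    choose! x hx using fun (n : ℕ) (h : ∃ x, ε * ((n : ℝ) + 1) ≤ F (n + 1) x) => h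
    exact ⟨x, hfreq.mono hx⟩
  have : (atTop ⊓ 𝓟 {n : ℕ | ε * ((n : ℝ) + 1) ≤ F (n + 1) (x n)}).NeBot :=
    frequently_mem_iff_neBot.1 hx
  set U := Ultrafilter.of (atTop ⊓ 𝓟 {n : ℕ | ε * ((n : ℝ) + 1) ≤ F (n + 1) (x n)})
  have hU : (U : Filter ℕ) ≤ atTop := (Ultrafilter.of_le _).trans inf_le_left
  have hbad : ∀ᶠ n : ℕ in (U : Filter ℕ), ε * ((n : ℝ) + 1) ≤ F (n + 1) (x n) :=
    le_principal_iff.1 ((Ultrafilter.of_le _).trans inf_le_right)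
  let T : C(Λ, Λ) := ⟨f, hf⟩
  obtain ⟨ν, hν⟩ : ∃ ν, Tendsto (fun n => empiricalMeasure f n (x n)) U (𝓝 ν) :=
    ⟨_, (U.map fun n => empiricalMeasure f n (x n)).le_nhds_lim⟩
  have hνinv : MeasurePreserving T (ν : Measure Λ) ν :=
    measurePreserving_of_tendsto_empiricalMeasure T hU x hν
  have hνgrowth : ε ≤ subadditiveGrowth F ν := by
    refine le_csInf ⟨_, mem_image_of_mem _ (mem_Ici.2 le_rfl)⟩ ?_
    rintro _ ⟨m, hm, rfl⟩
    have hm' : (0 : ℝ) < m := by exact_mod_cast (mem_Ici.1 hm)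
    obtain ⟨C, hC⟩ := mul_le_birkhoffSum_add_of_subadditive hFnn hsub'
      (fun n => (isCompact_range (hFc n)).bddAbove.imp fun C hC x => hC (mem_range_self x)) hm
    have hint := ((continuous_integral_probabilityMeasure ⟨F m, hFc m⟩).tendsto ν).comp hν
    have hzero : Tendsto (fun n : ℕ => C * (1 / ((n : ℝ) + 1))) U (𝓝 0) := by
      simpa using (tendsto_one_div_add_atTop_nhds_zero_nat.mono_left hU).const_mul C
    have hlim := hint.add hzero
    rw [le_div_iff₀ hm', ← add_zero (∫ x, F m x ∂(ν : Measure Λ))]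
    refine ge_of_tendsto hlim ?_
    filter_upwards [hbad] with n hn
    have hn' : (0 : ℝ) < (n : ℝ) + 1 := by positivity
    have h1 := hC (n + 1) (x n)
    have h2 : ε * m * ((n : ℝ) + 1) ≤ birkhoffSum f (F m) (n + 1) (x n) + C := by nlinarith
    rw [Function.comp_apply, integral_empiricalMeasure, birkhoffAverage, smul_eq_mul]
    push_cast
    rw [← div_eq_inv_mul, mul_one_div, ← add_div, le_div_iff₀ hn']
    exact h2
  obtain ⟨μ, hμ, hle⟩ := exists_ergodic_le_of_upperSemicontinuous T (subadditiveGrowth F)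
    (upperSemicontinuous_subadditiveGrowth hFc hFnn) (fun μ₁ μ₂ _ _ a b h₁ h₂ hab => by
      have ha : a ≠ ∞ := ne_top_of_le_ne_top ENNReal.one_ne_top (hab ▸ le_self_add)
      have hb : b ≠ ∞ := ne_top_of_le_ne_top ENNReal.one_ne_top (hab ▸ le_add_self)
      have : IsFiniteMeasure (a • μ₁ + b • μ₂) := ⟨by simp [ha.lt_top, hb.lt_top]⟩
      have h : MeasurePreserving T (a • μ₁ + b • μ₂) (a • μ₁ + b • μ₂) :=
        ⟨h₁.measurable, by
          rw [Measure.map_add _ _ h₁.measurable, Measure.map_smul, Measure.map_smul,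
            h₁.map_eq, h₂.map_eq]⟩
      refine tendsto_nhds_unique (tendsto_subadditiveGrowth hFc hFnn hsub' h) ?_
      refine (((tendsto_subadditiveGrowth hFc hFnn hsub' h₁).const_mul a.toReal).add
        ((tendsto_subadditiveGrowth hFc hFnn hsub' h₂).const_mul b.toReal)).congr fun n => ?_
      have := integral_smul_add_smul_measure μ₁ μ₂ ha hb ⟨F n, hFc n⟩
      simp only [ContinuousMap.coe_mk] at this
      rw [this]
      ring) ν hνinv
  have hμ0 : subadditiveGrowth F μ = 0 :=
    tendsto_nhds_unique (tendsto_subadditiveGrowth hFc hFnn hsub' hμ.toMeasurePreserving)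
      ((herg μ inferInstance hμ).congr fun n => by rw [one_div, div_eq_inv_mul])
  linarith
end

section
/- Let f : X → X be an expansive homeomorphism of a compact metric space X, i.e. there exists ε > 0 such that for all distinct x, y ∈ X there is n ∈ ℤ with d(f^n x, f^n y) ≥ ε. Then the entropy map μ ↦ h_μ(f), defined on the space of f-invariant Borel probability measures with the weak* topology, is upper semi-continuous. -/
open MeasureTheory

/-- The entropy H(P) = ∑ −μ(A) log μ(A) of a finite measurable partition, encoded by a
map p : X → S into a finite index type. -/
noncomputable def partitionEntropy {X : Type*} [MeasurableSpace X] (μ : Measure X)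
    {S : Type*} [Fintype S] (p : X → S) : ℝ :=
  ∑ s : S, Real.negMulLog ((μ (p ⁻¹' {s})).toReal)

/-- The entropy h_μ(T, P) of T with respect to a partition p, as the limit (= infimum)
of (1/n) H(⋁_{i<n} T^{-i} P). -/
noncomputable def entropyOfPartition {X : Type*} [MeasurableSpace X] (μ : Measure X)
    (T : X → X) {m : ℕ} (p : X → Fin m) : ℝ :=
  ⨅ n : ℕ, partitionEntropy μ (fun x => fun i : Fin (n + 1) => p (T^[(i : ℕ)] x)) / (n + 1)

/-- The Kolmogorov–Sinai entropy h_μ(T): the supremum over finite measurable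
partitions of the partition entropies. -/
noncomputable def ksEntropy {X : Type*} [MeasurableSpace X] (μ : Measure X)
    (T : X → X) : ℝ :=
  ⨆ (m : ℕ) (p : {q : X → Fin m // Measurable q}), entropyOfPartition μ T p.1

/-- The ℤ-iterates of a homeomorphism. -/
noncomputable def zIter {X : Type*} [TopologicalSpace X] (f : X ≃ₜ X) (k : ℤ) : X → X :=
  if 0 ≤ k then (⇑f)^[k.toNat] else (⇑f.symm)^[(-k).toNat]

section FiniteEntropy

variable {X A B C : Type*} [MeasurableSpace X] {μ : Measure X}
  [Fintype A] [MeasurableSpace A] [MeasurableSingletonClass A]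
  [Fintype B] [MeasurableSpace B] [MeasurableSingletonClass B]
  [Fintype C] [MeasurableSpace C] [MeasurableSingletonClass C]

theorem Real.negMulLog_sum_le {ι : Type*} (s : Finset ι) (w : ι → ℝ) (hw : ∀ i, 0 ≤ w i) :
    Real.negMulLog (∑ i ∈ s, w i) ≤ ∑ i ∈ s, Real.negMulLog (w i) := by
  simp only [Real.negMulLog, neg_mul, Finset.sum_neg_distrib, neg_le_neg_iff, Finset.sum_mul]
  refine Finset.sum_le_sum fun i hi => ?_
  rcases (hw i).eq_or_lt with h | h
  · simp [← h]
  · exact mul_le_mul_of_nonneg_left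
      (Real.log_le_log h (Finset.single_le_sum (fun j _ => hw j) hi)) (hw i)

theorem partitionEntropy_nonneg [IsProbabilityMeasure μ] {S : Type*} [Fintype S] (p : X → S) :
    0 ≤ partitionEntropy μ p :=
  Finset.sum_nonneg fun _ _ => Real.negMulLog_nonneg ENNReal.toReal_nonneg measureReal_le_one

theorem measureReal_preimage_singleton_eq_sum {B : Type*} [MeasurableSpace B]
    [MeasurableSingletonClass B] [IsFiniteMeasure μ] {p : X → A} {q : X → B}
    (hp : Measurable p) (hq : Measurable q) (b : B) :
    (μ (q ⁻¹' {b})).toReal = ∑ a, (μ ((fun x => (p x, q x)) ⁻¹' {(a, b)})).toReal := by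
  classical
  have h := sum_measureReal_preimage_singleton (μ := μ) (Finset.univ ×ˢ {b} : Finset (A × B))
    (f := fun x => (p x, q x)) fun y _ => (hp.prodMk hq) (measurableSet_singleton y)
  rw [Finset.sum_product] at h
  simp only [Finset.sum_singleton, measureReal_def] at h
  rw [h]
  congr 2
  ext x
  simp [eq_comm]

/-- A partition that is a function of another one has at most its entropy. -/
theorem partitionEntropy_le_of_factors {A : Type*} [Fintype A] [IsProbabilityMeasure μ]
    {p : X → A} {q : X → B} (hq : Measurable q) (h : ∀ x y, q x = q y → p x = p y) :
    partitionEntropy μ p ≤ partitionEntropy μ q := by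
  classical
  have : Nonempty X := nonempty_of_isProbabilityMeasure μ
  have : Nonempty A := ⟨p (Classical.arbitrary X)⟩
  obtain ⟨φ, rfl⟩ := (Function.factorsThrough_iff p).1 (fun x y => h x y : p.FactorsThrough q)
  unfold partitionEntropy
  rw [← Finset.sum_fiberwise (s := Finset.univ) (g := φ)]
  refine Finset.sum_le_sum fun a _ => ?_
  have hs := sum_measureReal_preimage_singleton (μ := μ) (Finset.univ.filter fun b => φ b = a)
    (f := q) fun y _ => hq (measurableSet_singleton y)
  have : (μ (φ ∘ q ⁻¹' {a})).toReal = ∑ b with φ b = a, (μ (q ⁻¹' {b})).toReal := by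
    simp only [measureReal_def] at hs
    rw [hs]
    congr 2
    ext x
    simp
  rw [this]
  exact Real.negMulLog_sum_le _ _ fun _ => ENNReal.toReal_nonneg

theorem partitionEntropy_congr [IsProbabilityMeasure μ] {p : X → A} {q : X → B}
    (hp : Measurable p) (hq : Measurable q) (h : ∀ x y, p x = p y ↔ q x = q y) :
    partitionEntropy μ p = partitionEntropy μ q :=
  le_antisymm (partitionEntropy_le_of_factors hq fun x y => (h x y).2)
    (partitionEntropy_le_of_factors hp fun x y => (h x y).1)

theorem partitionEntropy_comp {T : X → X} (hT : MeasurePreserving T μ μ) {p : X → A}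
    (hp : Measurable p) : partitionEntropy μ (p ∘ T) = partitionEntropy μ p := by
  unfold partitionEntropy
  refine Finset.sum_congr rfl fun a _ => ?_
  rw [Set.preimage_comp, hT.measure_preimage (hp (measurableSet_singleton a)).nullMeasurableSet]

theorem mul_log_sub_log_le {w u v z : ℝ} (hw : 0 ≤ w) (hu : w ≤ u) (hv : w ≤ v) (hz : w ≤ z) :
    w * (Real.log u + Real.log v - Real.log w - Real.log z) ≤ u * v / z - w := by
  rcases hw.eq_or_lt with rfl | h
  · simp only [zero_mul, sub_zero]
    positivity
  have hu' := h.trans_le hu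
  have hv' := h.trans_le hv
  have hz' := h.trans_le hz
  have : Real.log u + Real.log v - Real.log w - Real.log z = Real.log (u * v / (w * z)) := by
    rw [Real.log_div (by positivity) (by positivity), Real.log_mul hu'.ne' hv'.ne',
      Real.log_mul h.ne' hz'.ne']
    ring
  rw [this]
  have := Real.log_le_sub_one_of_pos (show 0 < u * v / (w * z) by positivity)
  calc _ ≤ w * (u * v / (w * z) - 1) := by gcongr
    _ = _ := by field_simp

/-- Submodularity of the entropy of a nonnegative weight on a product of three finite sets. -/
theorem sum_negMulLog_submodular {A B C : Type*} [Fintype A] [Fintype B] [Fintype C]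
    (w : A → B → C → ℝ) (hw : ∀ a b c, 0 ≤ w a b c) :
    (∑ a, ∑ b, ∑ c, Real.negMulLog (w a b c)) + ∑ c, Real.negMulLog (∑ a, ∑ b, w a b c) ≤
      (∑ a, ∑ c, Real.negMulLog (∑ b, w a b c)) + ∑ b, ∑ c, Real.negMulLog (∑ a, w a b c) := by
  set u : A → C → ℝ := fun a c => ∑ b, w a b c with hu
  set v : B → C → ℝ := fun b c => ∑ a, w a b c with hv
  set z : C → ℝ := fun c => ∑ a, ∑ b, w a b c with hz
  have hu0 : ∀ a c, 0 ≤ u a c := fun a c => Finset.sum_nonneg fun b _ => hw a b c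
  have hwu : ∀ a b c, w a b c ≤ u a c := fun a b c =>
    Finset.single_le_sum (f := fun b => w a b c) (fun b _ => hw a b c) (Finset.mem_univ b)
  have hwv : ∀ a b c, w a b c ≤ v b c := fun a b c =>
    Finset.single_le_sum (f := fun a => w a b c) (fun a _ => hw a b c) (Finset.mem_univ a)
  have hwz : ∀ a b c, w a b c ≤ z c := fun a b c => (hwu a b c).trans <|
    Finset.single_le_sum (f := fun a => u a c) (fun a _ => hu0 a c) (Finset.mem_univ a)
  have hvz : ∀ c, ∑ b, v b c = z c := fun c => Finset.sum_comm
  have key : ∑ c, ∑ a, ∑ b, w a b c *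
      (Real.log (u a c) + Real.log (v b c) - Real.log (w a b c) - Real.log (z c)) ≤ 0 := by
    refine Finset.sum_nonpos fun c _ => ?_
    calc _ ≤ ∑ a, ∑ b, (u a c * v b c / z c - w a b c) :=
          Finset.sum_le_sum fun a _ => Finset.sum_le_sum fun b _ =>
            mul_log_sub_log_le (hw a b c) (hwu a b c) (hwv a b c) (hwz a b c)
      _ = (∑ a, u a c) * (∑ b, v b c) / z c - z c := by
          simp only [Finset.sum_sub_distrib, ← Finset.sum_div, Finset.sum_mul_sum, hz]
      _ = 0 := by
          rw [hvz, show ∑ a, u a c = z c from rfl]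
          rcases eq_or_ne (z c) 0 with h | h
          · simp [h]
          · field_simp
            simp
  have e1 : (∑ a, ∑ b, ∑ c, Real.negMulLog (w a b c)) =
      -∑ c, ∑ a, ∑ b, w a b c * Real.log (w a b c) := by
    rw [Finset.sum_congr rfl fun a _ => Finset.sum_comm, Finset.sum_comm]
    simp only [Real.negMulLog, neg_mul, Finset.sum_neg_distrib]
  have e2 : (∑ c, Real.negMulLog (z c)) = -∑ c, ∑ a, ∑ b, w a b c * Real.log (z c) := by
    simp only [Real.negMulLog, neg_mul, Finset.sum_neg_distrib, hz, Finset.sum_mul]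
  have e3 : (∑ a, ∑ c, Real.negMulLog (u a c)) =
      -∑ c, ∑ a, ∑ b, w a b c * Real.log (u a c) := by
    rw [Finset.sum_comm]
    simp only [Real.negMulLog, neg_mul, Finset.sum_neg_distrib, hu, Finset.sum_mul]
  have e4 : (∑ b, ∑ c, Real.negMulLog (v b c)) =
      -∑ c, ∑ a, ∑ b, w a b c * Real.log (v b c) := by
    rw [Finset.sum_comm]
    simp only [Real.negMulLog, neg_mul, Finset.sum_neg_distrib, hv, Finset.sum_mul]
    congr 1
    exact Finset.sum_congr rfl fun c _ => Finset.sum_comm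
  simp only [mul_sub, mul_add, Finset.sum_sub_distrib, Finset.sum_add_distrib] at key
  rw [e1, e2, e3, e4]
  linarith

theorem partitionEntropy_submodular [IsFiniteMeasure μ] {p : X → A} {q : X → B} {r : X → C}
    (hp : Measurable p) (hq : Measurable q) (hr : Measurable r) :
    partitionEntropy μ (fun x => (p x, q x, r x)) + partitionEntropy μ r ≤
      partitionEntropy μ (fun x => (p x, r x)) + partitionEntropy μ (fun x => (q x, r x)) := by
  have h := sum_negMulLog_submodular
    (fun a b c => (μ ((fun x => (p x, q x, r x)) ⁻¹' {(a, b, c)})).toReal)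
    fun _ _ _ => ENNReal.toReal_nonneg
  have h1 : ∀ b c, ∑ a, (μ ((fun x => (p x, q x, r x)) ⁻¹' {(a, b, c)})).toReal =
      (μ ((fun x => (q x, r x)) ⁻¹' {(b, c)})).toReal := fun b c =>
    (measureReal_preimage_singleton_eq_sum hp (hq.prodMk hr) (b, c)).symm
  have h2 : ∀ a c, ∑ b, (μ ((fun x => (p x, q x, r x)) ⁻¹' {(a, b, c)})).toReal =
      (μ ((fun x => (p x, r x)) ⁻¹' {(a, c)})).toReal := fun a c => by
    rw [measureReal_preimage_singleton_eq_sum hq (hp.prodMk hr) (a, c)]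
    refine Finset.sum_congr rfl fun b _ => ?_
    congr 2
    ext x
    simp only [Set.mem_preimage, Set.mem_singleton_iff, Prod.mk.injEq]
    tauto
  have h3 : ∀ c, ∑ a, (μ ((fun x => (p x, r x)) ⁻¹' {(a, c)})).toReal = (μ (r ⁻¹' {c})).toReal :=
    fun c => (measureReal_preimage_singleton_eq_sum hp hr c).symm
  simp only [h1, h2, h3] at h
  simpa only [partitionEntropy, Fintype.sum_prod_type] using h

theorem partitionEntropy_prodMk_le [IsProbabilityMeasure μ] {p : X → A} {q : X → B}
    (hp : Measurable p) (hq : Measurable q) :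
    partitionEntropy μ (fun x => (p x, q x)) ≤ partitionEntropy μ p + partitionEntropy μ q := by
  have h := partitionEntropy_submodular (μ := μ) hp hq (measurable_const (a := ()))
  have h0 := partitionEntropy_nonneg (μ := μ) (fun _ : X => ())
  rw [partitionEntropy_congr (hp.prodMk measurable_const) hp (by simp),
    partitionEntropy_congr (hq.prodMk measurable_const) hq (by simp),
    partitionEntropy_congr (hp.prodMk (hq.prodMk measurable_const)) (hp.prodMk hq) (by simp)] at h
  linarith

/-- Conditioning on a finer partition decreases conditional entropy. -/
theorem partitionEntropy_cond_anti [IsProbabilityMeasure μ] {p : X → A} {q : X → B} {r : X → C}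
    (hp : Measurable p) (hq : Measurable q) (hr : Measurable r)
    (h : ∀ x y, q x = q y → r x = r y) :
    partitionEntropy μ (fun x => (p x, q x)) - partitionEntropy μ q ≤
      partitionEntropy μ (fun x => (p x, r x)) - partitionEntropy μ r := by
  have hs := partitionEntropy_submodular (μ := μ) hp hq hr
  rw [partitionEntropy_congr (hq.prodMk hr) hq fun x y => by simpa using h x y,
    partitionEntropy_congr (hp.prodMk (hq.prodMk hr)) (hp.prodMk hq) fun x y => by
      simpa using fun _ => h x y] at hs
  linarith

/-- Conditional entropy is small, uniformly, for partitions that agree up to a small set. -/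
theorem exists_partitionEntropy_cond_lt (A : Type*) [Fintype A] [MeasurableSpace A]
    [MeasurableSingletonClass A] (μ : Measure X) [IsProbabilityMeasure μ] {c : ℝ} (hc : 0 < c) :
    ∃ η > 0, ∀ p q : X → A, Measurable p → Measurable q → (μ {x | p x ≠ q x}).toReal < η →
      partitionEntropy μ (fun x => (p x, q x)) - partitionEntropy μ q < c := by
  classical
  set c' : ℝ := c / (Fintype.card A * Fintype.card A + 1) with hc'
  have hc'0 : 0 < c' := by positivity
  obtain ⟨η, hη, hφ⟩ := Metric.uniformContinuousOn_iff.1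
    ((isCompact_Icc (a := (0 : ℝ)) (b := 1)).uniformContinuousOn_of_continuous
      Real.continuous_negMulLog.continuousOn) c' hc'0
  refine ⟨η, hη, fun p q hp hq hpq => ?_⟩
  set w : A → A → ℝ := fun a b => (μ ((fun x => (p x, q x)) ⁻¹' {(a, b)})).toReal with hw
  set t : A → A → ℝ := fun a b => if a = b then (μ (q ⁻¹' {b})).toReal else 0 with ht
  have hdist : ∀ a b, |w a b - t a b| < η := by
    intro a b
    refine lt_of_le_of_lt ?_ hpq
    by_cases hab : a = b
    · subst hab
      have hsub : (fun x => (p x, q x)) ⁻¹' {(a, a)} ⊆ q ⁻¹' {a} := fun x hx => by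
        simp only [Set.mem_preimage, Set.mem_singleton_iff, Prod.mk.injEq] at hx
        exact hx.2
      have hm := measureReal_mono (μ := μ) hsub
      have hle : q ⁻¹' {a} ⊆ (fun x => (p x, q x)) ⁻¹' {(a, a)} ∪ {x | p x ≠ q x} := fun x hx => by
        simp only [Set.mem_preimage, Set.mem_singleton_iff] at hx
        by_cases hpx : p x = q x
        · left; simp [hx, hpx]
        · right; exact hpx
      have hm' := (measureReal_mono (μ := μ) hle).trans (measureReal_union_le _ _)
      simp only [hw, ht, if_true, measureReal_def] at hm hm' ⊢
      rw [abs_le]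
      constructor <;> linarith
    · simp only [hw, ht, if_neg hab, sub_zero]
      rw [abs_of_nonneg ENNReal.toReal_nonneg]
      refine measureReal_mono (μ := μ) fun x hx => ?_
      simp only [Set.mem_preimage, Set.mem_singleton_iff, Prod.mk.injEq] at hx
      simpa [hx.1, hx.2] using hab
  have hterm : ∀ a b, Real.negMulLog (w a b) - Real.negMulLog (t a b) ≤ c' := by
    intro a b
    have hwI : w a b ∈ Set.Icc (0 : ℝ) 1 := ⟨ENNReal.toReal_nonneg, measureReal_le_one⟩
    have htI : t a b ∈ Set.Icc (0 : ℝ) 1 := by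
      simp only [ht]
      split_ifs
      · exact ⟨ENNReal.toReal_nonneg, measureReal_le_one⟩
      · simp
    exact (le_abs_self _).trans (hφ _ hwI _ htI (hdist a b)).le
  have hq' : partitionEntropy μ q = ∑ a, ∑ b, Real.negMulLog (t a b) := by
    simp only [partitionEntropy, ht]
    rw [Finset.sum_comm]
    refine Finset.sum_congr rfl fun b _ => ?_
    rw [Finset.sum_eq_single b] <;> simp +contextual
  have hpq' : partitionEntropy μ (fun x => (p x, q x)) = ∑ a, ∑ b, Real.negMulLog (w a b) := by
    simp only [partitionEntropy, Fintype.sum_prod_type, hw]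
  rw [hq', hpq', ← Finset.sum_sub_distrib]
  simp only [← Finset.sum_sub_distrib]
  calc _ ≤ ∑ _a : A, ∑ _b : A, c' := Finset.sum_le_sum fun a _ => Finset.sum_le_sum fun b _ =>
        hterm a b
    _ = (Fintype.card A * Fintype.card A) * c' := by
        simp [Finset.sum_const, mul_assoc]
    _ < (Fintype.card A * Fintype.card A + 1) * c' := by gcongr; linarith
    _ = c := by rw [hc']; field_simp

end FiniteEntropy

/-- The itinerary of length `n` of a point with respect to a partition `p`. -/
def itinerary {X S : Type*} (T : X → X) (n : ℕ) (p : X → S) : X → Fin n → S :=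
  fun x i => p (T^[(i : ℕ)] x)

section Dynamics

variable {X A B : Type*} [MeasurableSpace X] {μ : Measure X} {T : X → X}
  [Fintype A] [MeasurableSpace A] [MeasurableSingletonClass A]
  [Fintype B] [MeasurableSpace B] [MeasurableSingletonClass B]

theorem itinerary_eq_iff {X S : Type*} {T : X → X} {n : ℕ} {p : X → S} {x y : X} :
    itinerary T n p x = itinerary T n p y ↔ ∀ i < n, p (T^[i] x) = p (T^[i] y) := by
  simp only [funext_iff, itinerary]
  exact ⟨fun h i hi => h ⟨i, hi⟩, fun h i => h i i.2⟩

theorem measurable_itinerary {S : Type*} [MeasurableSpace S] (hT : Measurable T) (n : ℕ)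
    {p : X → S} (hp : Measurable p) : Measurable (itinerary T n p) :=
  measurable_pi_lambda _ fun i => hp.comp (hT.iterate i)

theorem entropyOfPartition_eq (m : ℕ) (p : X → Fin m) : entropyOfPartition μ T p =
    ⨅ n : ℕ, partitionEntropy μ (itinerary T (n + 1) p) / (n + 1) := rfl

theorem entropyOfPartition_nonneg [IsProbabilityMeasure μ] {m : ℕ} (p : X → Fin m) :
    0 ≤ entropyOfPartition μ T p :=
  Real.iInf_nonneg fun _ => div_nonneg (partitionEntropy_nonneg _) (by positivity)

theorem entropyOfPartition_le [IsProbabilityMeasure μ] {m : ℕ} (p : X → Fin m) (n : ℕ) :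
    entropyOfPartition μ T p ≤ partitionEntropy μ (itinerary T (n + 1) p) / (n + 1) :=
  ciInf_le ⟨0, by
    rintro _ ⟨k, rfl⟩
    exact div_nonneg (partitionEntropy_nonneg _) (by positivity)⟩ n

theorem subadditive_partitionEntropy_itinerary [IsProbabilityMeasure μ]
    (hT : MeasurePreserving T μ μ) {p : X → A} (hp : Measurable p) :
    Subadditive fun n => partitionEntropy μ (itinerary T n p) := by
  intro m n
  have hm := measurable_itinerary hT.measurable m hp
  have hn := measurable_itinerary hT.measurable n hp
  have hn' : Measurable (itinerary T n p ∘ T^[m]) := hn.comp (hT.measurable.iterate m)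
  calc partitionEntropy μ (itinerary T (m + n) p)
      ≤ partitionEntropy μ (fun x => (itinerary T m p x, (itinerary T n p ∘ T^[m]) x)) := by
        refine partitionEntropy_le_of_factors (hm.prodMk hn') fun x y h => ?_
        simp only [Prod.mk.injEq, Function.comp_apply, itinerary_eq_iff,
          ← Function.iterate_add_apply] at h ⊢
        intro i hi
        rcases lt_or_ge i m with him | him
        · exact h.1 i him
        · simpa [Nat.sub_add_cancel him] using h.2 (i - m) (by omega)
    _ ≤ _ := partitionEntropy_prodMk_le hm hn'
    _ = _ := by rw [partitionEntropy_comp (hT.iterate m) hn]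

/-- The conditional entropy of itineraries grows at most linearly. -/
theorem partitionEntropy_itinerary_le [IsProbabilityMeasure μ] (hT : MeasurePreserving T μ μ)
    {p : X → A} {q : X → B} (hp : Measurable p) (hq : Measurable q) (n : ℕ) :
    partitionEntropy μ (itinerary T n p) ≤ partitionEntropy μ (itinerary T n q) +
      n * (partitionEntropy μ (fun x => (p x, q x)) - partitionEntropy μ q) := by
  have hP := fun n => measurable_itinerary hT.measurable n hp
  have hQ := fun n => measurable_itinerary hT.measurable n hq
  suffices h : partitionEntropy μ (fun x => (itinerary T n p x, itinerary T n q x)) ≤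
      partitionEntropy μ (itinerary T n q) +
      n * (partitionEntropy μ (fun x => (p x, q x)) - partitionEntropy μ q) from
    (partitionEntropy_le_of_factors ((hP n).prodMk (hQ n)) fun x y hxy =>
      (Prod.mk.inj hxy).1).trans h
  induction n with
  | zero =>
    rw [partitionEntropy_congr ((hP 0).prodMk (hQ 0)) (hQ 0) fun x y => by
      simp [itinerary_eq_iff]]
    simp
  | succ n ih =>
    have hp' : Measurable (p ∘ T^[n]) := hp.comp (hT.measurable.iterate n)
    have hq' : Measurable (q ∘ T^[n]) := hq.comp (hT.measurable.iterate n)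
    have s1 := partitionEntropy_submodular (μ := μ) (hP n) hp' ((hQ n).prodMk hq')
    have s2 := partitionEntropy_submodular (μ := μ) (hP n) hq' (hQ n)
    have s3 := partitionEntropy_submodular (μ := μ) hp' (hQ n) hq'
    have e0 : partitionEntropy μ (fun x => (itinerary T (n + 1) p x, itinerary T (n + 1) q x)) =
        partitionEntropy μ
          (fun x => (itinerary T n p x, (p ∘ T^[n]) x, itinerary T n q x, (q ∘ T^[n]) x)) :=
      partitionEntropy_congr ((hP _).prodMk (hQ _)) ((hP n).prodMk (hp'.prodMk ((hQ n).prodMk hq')))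
        fun x y => by
          simp only [Prod.mk.injEq, itinerary_eq_iff, Nat.forall_lt_succ_right,
            Function.comp_apply]
          tauto
    have e1 : partitionEntropy μ (itinerary T (n + 1) q) =
        partitionEntropy μ (fun x => (itinerary T n q x, (q ∘ T^[n]) x)) :=
      partitionEntropy_congr (hQ _) ((hQ n).prodMk hq') fun x y => by
        simp only [Prod.mk.injEq, itinerary_eq_iff, Nat.forall_lt_succ_right,
          Function.comp_apply]
    have e2 : partitionEntropy μ (fun x => ((q ∘ T^[n]) x, itinerary T n q x)) =
        partitionEntropy μ (fun x => (itinerary T n q x, (q ∘ T^[n]) x)) :=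
      partitionEntropy_congr (hq'.prodMk (hQ n)) ((hQ n).prodMk hq') fun x y => by
        simp only [Prod.mk.injEq]
        tauto
    have e3 : partitionEntropy μ (fun x => (itinerary T n p x, (q ∘ T^[n]) x, itinerary T n q x)) =
        partitionEntropy μ (fun x => (itinerary T n p x, itinerary T n q x, (q ∘ T^[n]) x)) :=
      partitionEntropy_congr ((hP n).prodMk (hq'.prodMk (hQ n)))
        ((hP n).prodMk ((hQ n).prodMk hq')) fun x y => by
          simp only [Prod.mk.injEq]
          tauto
    have e4 := partitionEntropy_comp (hT.iterate n) (hp.prodMk hq)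
    rw [show (fun x => (p x, q x)) ∘ T^[n] = fun x => ((p ∘ T^[n]) x, (q ∘ T^[n]) x) from rfl] at e4
    have e5 : partitionEntropy μ (q ∘ T^[n]) = partitionEntropy μ q :=
      partitionEntropy_comp (hT.iterate n) hq
    rw [e0, e1]
    push_cast
    linarith

/-- If shifts of `q` are approximated by functions of long itineraries of `p`, then the entropy
relative to `q` is at most the entropy relative to `p`. -/
theorem entropyOfPartition_le_of_approx [IsProbabilityMeasure μ] (hT : MeasurePreserving T μ μ)
    {m k : ℕ} {p : X → Fin m} {q : X → Fin k} (hp : Measurable p) (hq : Measurable q)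
    (happ : ∀ η > 0, ∃ (N M : ℕ) (ψ : (Fin M → Fin m) → Fin k),
      (μ {x | q (T^[N] x) ≠ ψ (itinerary T M p x)}).toReal < η) :
    entropyOfPartition μ T q ≤ entropyOfPartition μ T p := by
  have hsub := subadditive_partitionEntropy_itinerary hT hp
  set u : ℕ → ℝ := fun n => partitionEntropy μ (itinerary T n p) with hu
  have hbdd : BddBelow (Set.range fun n => u n / n) := ⟨0, by
    rintro _ ⟨n, rfl⟩
    exact div_nonneg (partitionEntropy_nonneg _) n.cast_nonneg⟩
  have hlim : hsub.lim ≤ entropyOfPartition μ T p := by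
    refine le_ciInf fun n => ?_
    have h := hsub.lim_le_div hbdd n.succ_ne_zero
    rw [Nat.cast_succ] at h
    exact h
  refine le_trans (le_of_forall_pos_le_add fun c hc => ?_) hlim
  obtain ⟨η, hη, hc'⟩ := exists_partitionEntropy_cond_lt (Fin k) μ hc
  obtain ⟨N, M, ψ, hψ⟩ := happ η hη
  have hpM := measurable_itinerary hT.measurable M hp
  have hψm : Measurable fun x => ψ (itinerary T M p x) := (measurable_of_countable ψ).comp hpM
  have hqN : Measurable (q ∘ T^[N]) := hq.comp (hT.measurable.iterate N)
  have hcond := (partitionEntropy_cond_anti (μ := μ) hqN hpM hψm fun x y h => by simp [h]).trans_lt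
    (hc' _ _ hqN hψm hψ)
  have hbound : ∀ n : ℕ, n ≠ 0 → entropyOfPartition μ T q ≤ u n / n + u M / n + c := by
    intro n hn
    have h1 : entropyOfPartition μ T q ≤ partitionEntropy μ (itinerary T n q) / n := by
      obtain ⟨n, rfl⟩ := Nat.exists_eq_succ_of_ne_zero hn
      simpa using entropyOfPartition_le (μ := μ) (T := T) q n
    have h2 : partitionEntropy μ (itinerary T n q) =
        partitionEntropy μ (itinerary T n (q ∘ T^[N])) := by
      rw [← partitionEntropy_comp (hT.iterate N) (measurable_itinerary hT.measurable n hq)]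
      congr 1
      ext x i
      simp only [Function.comp_apply, itinerary, ← Function.iterate_add_apply, add_comm]
    have h3 := partitionEntropy_itinerary_le hT hqN hpM n
    have h4 : partitionEntropy μ (itinerary T n (itinerary T M p)) ≤ u (n + M) := by
      refine partitionEntropy_le_of_factors (measurable_itinerary hT.measurable _ hp)
        fun x y h => ?_
      simp only [itinerary_eq_iff, ← Function.iterate_add_apply] at h ⊢
      exact fun i hi j hj => h _ (by omega)
    have h5 := hsub n M
    have hn0 : (0 : ℝ) < n := by positivity
    have h6 : (n : ℝ) * (partitionEntropy μ (fun x => ((q ∘ T^[N]) x, itinerary T M p x)) -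
        partitionEntropy μ (itinerary T M p)) ≤ n * c := by gcongr
    refine h1.trans ?_
    rw [h2, div_le_iff₀ hn0]
    have : (u n / n + u M / n + c) * n = u n + u M + n * c := by field_simp
    rw [this]
    linarith
  have ht : Filter.Tendsto (fun n : ℕ => u n / n + u M / n + c) Filter.atTop
      (nhds (hsub.lim + 0 + c)) :=
    ((hsub.tendsto_lim hbdd).add (tendsto_const_div_atTop_nhds_zero_nat _)).add_const c
  rw [add_zero] at ht
  exact ge_of_tendsto ht ((Filter.eventually_ne_atTop 0).mono hbound)

theorem ksEntropy_nonneg [IsProbabilityMeasure μ] : 0 ≤ ksEntropy μ T :=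
  Real.iSup_nonneg fun _ => Real.iSup_nonneg fun _ => entropyOfPartition_nonneg _

/-- A partition that dominates all others computes the Kolmogorov–Sinai entropy. -/
theorem ksEntropy_eq_of_forall_le [IsProbabilityMeasure μ] {m : ℕ} {p : X → Fin m}
    (hp : Measurable p) (h : ∀ (k : ℕ) (q : X → Fin k), Measurable q →
      entropyOfPartition μ T q ≤ entropyOfPartition μ T p) :
    ksEntropy μ T = entropyOfPartition μ T p := by
  have h0 := entropyOfPartition_nonneg (μ := μ) (T := T) p
  have hin : ∀ k, ⨆ q : {q : X → Fin k // Measurable q}, entropyOfPartition μ T q.1 ≤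
      entropyOfPartition μ T p := fun k => Real.iSup_le (fun q => h k q.1 q.2) h0
  refine le_antisymm (Real.iSup_le hin h0) ?_
  refine le_trans ?_ (le_ciSup (f := fun k : ℕ =>
    ⨆ q : {q : X → Fin k // Measurable q}, entropyOfPartition μ T q.1)
    ⟨entropyOfPartition μ T p, by rintro _ ⟨k, rfl⟩; exact hin k⟩ m)
  exact le_ciSup (f := fun q : {q : X → Fin m // Measurable q} => entropyOfPartition μ T q.1)
    ⟨entropyOfPartition μ T p, by rintro _ ⟨q, rfl⟩; exact h m q.1 q.2⟩ ⟨p, hp⟩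

end Dynamics

section Expansive

variable {X : Type*} [MetricSpace X]

theorem continuous_zIter (f : X ≃ₜ X) (k : ℤ) : Continuous (zIter f k) := by
  unfold zIter
  split_ifs
  · exact f.continuous.iterate _
  · exact f.symm.continuous.iterate _

theorem zIter_iterate (f : X ≃ₜ X) {k : ℤ} {N : ℕ} (h : -(N : ℤ) ≤ k) (x : X) :
    zIter f k (f^[N] x) = f^[(k + N).toNat] x := by
  unfold zIter
  split_ifs with hk
  · rw [← Function.iterate_add_apply]
    congr 2
    omega
  · have hN : N = (-k).toNat + (k + N).toNat := by omega
    conv_lhs => rw [hN, Function.iterate_add_apply]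
    exact (Function.LeftInverse.iterate f.symm_apply_apply _) _

/-- Expansiveness is uniform on compact sets of pairs avoiding the diagonal. -/
theorem exists_lt_dist_iterate_of_expansive (f : X ≃ₜ X) {ε δ : ℝ} (hδ : δ < ε)
    (hexp : ∀ x y : X, x ≠ y → ∃ k : ℤ, ε ≤ dist (zIter f k x) (zIter f k y))
    {D : Set (X × X)} (hD : IsCompact D) (hdiag : ∀ z ∈ D, z.1 ≠ z.2) :
    ∃ N : ℕ, ∀ x y : X, (f^[N] x, f^[N] y) ∈ D →
      ∃ i < 2 * N + 1, δ < dist (f^[i] x) (f^[i] y) := by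
  obtain ⟨t, ht⟩ := hD.elim_finite_subcover
    (fun k : ℤ => {z : X × X | δ < dist (zIter f k z.1) (zIter f k z.2)})
    (fun k => isOpen_lt continuous_const
      (((continuous_zIter f k).comp continuous_fst).dist
        ((continuous_zIter f k).comp continuous_snd)))
    (fun z hz => by
      obtain ⟨k, hk⟩ := hexp _ _ (hdiag z hz)
      exact Set.mem_iUnion.2 ⟨k, hδ.trans_le hk⟩)
  refine ⟨t.sup Int.natAbs, fun x y hxy => ?_⟩
  obtain ⟨k, hk, hlt⟩ := Set.mem_iUnion₂.1 (ht hxy)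
  have hkN : k.natAbs ≤ t.sup Int.natAbs := Finset.le_sup (f := Int.natAbs) hk
  refine ⟨(k + (t.sup Int.natAbs : ℕ)).toNat, by omega, ?_⟩
  rw [Set.mem_ofPred_eq, zIter_iterate f (by omega), zIter_iterate f (by omega)] at hlt
  exact hlt

variable [CompactSpace X] [MeasurableSpace X] [BorelSpace X]

/-- Small-diameter partitions whose boundaries are null exist. -/
theorem exists_partition_dist_lt_ae_continuousAt (ν : Measure X) [IsFiniteMeasure ν] {δ : ℝ}
    (hδ : 0 < δ) : ∃ (m : ℕ) (p : X → Fin m), Measurable p ∧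
      (∀ x y, p x = p y → dist x y < δ) ∧ ∀ᵐ x ∂ν, ContinuousAt p x := by
  classical
  have hr : ∀ c : X, ∃ r, 0 < r ∧ r < δ / 2 ∧ ν (frontier (Metric.ball c r)) = 0 := fun c => by
    obtain ⟨r, hr, h⟩ := exists_null_frontier_thickening ν {c} (half_pos hδ)
    exact ⟨r, hr.1, hr.2, by rwa [Metric.thickening_singleton] at h⟩
  choose r hr0 hrδ hrν using hr
  obtain ⟨t, -, ht⟩ := isCompact_univ.elim_nhds_subcover (fun c => Metric.ball c (r c))
    fun c _ => Metric.ball_mem_nhds c (hr0 c)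
  let p₀ : X → (t → Bool) := fun x c => decide (x ∈ Metric.ball (c : X) (r c))
  let e := Fintype.equivFin (t → Bool)
  refine ⟨_, e ∘ p₀, ?_, ?_, ?_⟩
  · refine (measurable_of_countable e).comp (measurable_pi_lambda _ fun c => measurable_to_bool ?_)
    convert (Metric.isOpen_ball (x := (c : X)) (ε := r c)).measurableSet using 1
    ext x
    simp [p₀]
  · intro x y hxy
    have hxy' : p₀ x = p₀ y := e.injective hxy
    obtain ⟨c, hc, hxc⟩ := Set.mem_iUnion₂.1 (ht (Set.mem_univ x))
    have hyc : y ∈ Metric.ball c (r c) := by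
      have := congrFun hxy' ⟨c, hc⟩
      simp only [p₀, decide_eq_decide] at this
      exact this.1 hxc
    have h1 := Metric.mem_ball.1 hxc
    have h2 := Metric.mem_ball.1 hyc
    have h3 := hrδ c
    have h4 := dist_triangle_right x y c
    linarith
  · have hall : ∀ᵐ x ∂ν, ∀ c : t, x ∉ frontier (Metric.ball (c : X) (r c)) :=
      ae_all_iff.2 fun c => measure_eq_zero_iff_ae_notMem.1 (hrν c)
    filter_upwards [hall] with x hx
    refine (continuous_of_discreteTopology (f := e)).continuousAt.comp
      (continuousAt_pi.2 fun c => ?_)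
    refine (Filter.EventuallyEq.continuousAt (y := p₀ x c) ?_)
    by_cases hxc : x ∈ Metric.ball (c : X) (r c)
    · filter_upwards [Metric.isOpen_ball.mem_nhds hxc] with y hy
      simp [p₀, Metric.mem_ball.1 hxc, Metric.mem_ball.1 hy]
    · have hcl : x ∉ closure (Metric.ball (c : X) (r c)) := fun h =>
        hx c ⟨h, fun h' => hxc (interior_subset h')⟩
      filter_upwards [isClosed_closure.isOpen_compl.mem_nhds hcl] with y hy
      have hyc : y ∉ Metric.ball (c : X) (r c) := fun h => hy (subset_closure h)
      simp only [p₀, hxc, hyc]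

/-- Small-diameter partitions generate: they compute the entropy of an expansive system. -/
theorem ksEntropy_eq_entropyOfPartition_of_expansive (f : X ≃ₜ X) {ε δ : ℝ} (hδ : δ < ε)
    (hexp : ∀ x y : X, x ≠ y → ∃ k : ℤ, ε ≤ dist (zIter f k x) (zIter f k y))
    {μ : Measure X} [IsProbabilityMeasure μ] (hμ : MeasurePreserving f μ μ)
    {m : ℕ} {p : X → Fin m} (hp : Measurable p) (hpδ : ∀ x y, p x = p y → dist x y < δ) :
    ksEntropy μ f = entropyOfPartition μ f p := by
  classical
  refine ksEntropy_eq_of_forall_le hp fun k q hq => entropyOfPartition_le_of_approx hμ hp hq ?_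
  intro η hη
  have : Nonempty X := nonempty_of_isProbabilityMeasure μ
  have i₀ : Fin k := q (Classical.arbitrary X)
  have hk : 0 < k := i₀.pos
  have hK : ∀ i, ∃ K ⊆ q ⁻¹' {i}, IsClosed K ∧ μ (q ⁻¹' {i} \ K) < ENNReal.ofReal (η / k) :=
    fun i => (hq (measurableSet_singleton i)).exists_isClosed_sdiff_lt (measure_ne_top μ _)
      (by simp only [ne_eq, ENNReal.ofReal_eq_zero, not_le]; positivity)
  choose K hKq hKc hKμ using hK
  let D : Set (X × X) := ⋃ (i) (j) (_ : i ≠ j), K i ×ˢ K j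
  have hD : IsCompact D := by
    refine isCompact_iUnion fun i => isCompact_iUnion fun j => isCompact_iUnion fun _ => ?_
    exact (hKc i).isCompact.prod (hKc j).isCompact
  obtain ⟨N, hN⟩ := exists_lt_dist_iterate_of_expansive f hδ hexp hD (by
    rintro ⟨x, y⟩ hz (hxy : x = y)
    subst hxy
    simp only [D, Set.mem_iUnion, Set.mem_prod] at hz
    obtain ⟨i, j, hij, hi, hj⟩ := hz
    exact hij ((hKq i hi).symm.trans (hKq j hj)))
  have hsep : ∀ x y i j, itinerary f (2 * N + 1) p x = itinerary f (2 * N + 1) p y →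
      f^[N] x ∈ K i → f^[N] y ∈ K j → i = j := by
    intro x y i j h hi hj
    by_contra hij
    obtain ⟨l, hl, hlt⟩ := hN x y
      (Set.mem_iUnion.2 ⟨i, Set.mem_iUnion.2 ⟨j, Set.mem_iUnion.2 ⟨hij, hi, hj⟩⟩⟩)
    exact absurd (hpδ _ _ (itinerary_eq_iff.1 h l hl)) hlt.not_gt
  let ψ : (Fin (2 * N + 1) → Fin m) → Fin k := fun s =>
    if h : ∃ i x, itinerary f (2 * N + 1) p x = s ∧ f^[N] x ∈ K i then h.choose else i₀
  refine ⟨N, 2 * N + 1, ψ, ?_⟩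
  have hψ : ∀ x i, f^[N] x ∈ K i → ψ (itinerary f (2 * N + 1) p x) = i := by
    intro x i hx
    have h : ∃ i y, itinerary f (2 * N + 1) p y = itinerary f (2 * N + 1) p x ∧ f^[N] y ∈ K i :=
      ⟨i, x, rfl, hx⟩
    obtain ⟨y, hy, hyK⟩ := h.choose_spec
    simp only [ψ, dif_pos h]
    exact hsep y x _ _ hy hyK hx
  have hsub : {x | q (f^[N] x) ≠ ψ (itinerary f (2 * N + 1) p x)} ⊆
      f^[N] ⁻¹' ⋃ i, (q ⁻¹' {i} \ K i) := by
    intro x hx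
    refine Set.mem_iUnion.2 ⟨q (f^[N] x), rfl, fun hK => hx ?_⟩
    exact (hψ x _ hK).symm
  have hmeas : MeasurableSet (⋃ i, (q ⁻¹' {i} \ K i)) :=
    MeasurableSet.iUnion fun i => (hq (measurableSet_singleton i)).diff (hKc i).measurableSet
  have hlt : μ {x | q (f^[N] x) ≠ ψ (itinerary f (2 * N + 1) p x)} < ENNReal.ofReal η := by
    calc _ ≤ μ (f^[N] ⁻¹' ⋃ i, (q ⁻¹' {i} \ K i)) := measure_mono hsub
      _ = μ (⋃ i, (q ⁻¹' {i} \ K i)) := (hμ.iterate N).measure_preimage hmeas.nullMeasurableSet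
      _ ≤ ∑ i, μ (q ⁻¹' {i} \ K i) := measure_iUnion_fintype_le _ _
      _ < ∑ _i : Fin k, ENNReal.ofReal (η / k) :=
        ENNReal.sum_lt_sum_of_nonempty ⟨i₀, Finset.mem_univ _⟩ fun i _ => hKμ i
      _ = ENNReal.ofReal η := by
        rw [Finset.sum_const, Finset.card_univ, Fintype.card_fin, nsmul_eq_mul,
          ← ENNReal.ofReal_natCast, ← ENNReal.ofReal_mul (by positivity)]
        congr 1
        field_simp
  exact (ENNReal.lt_ofReal_iff_toReal_lt (measure_ne_top μ _)).1 hlt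

end Expansive

section WeakConvergence

variable {X : Type*} [MetricSpace X] [MeasurableSpace X] [BorelSpace X]

/-- The entropy of a partition with null boundary is continuous in the weak* topology. -/
theorem tendsto_partitionEntropy_of_ae_continuousAt {μ : ℕ → Measure X} {ν : Measure X}
    [∀ k, IsProbabilityMeasure (μ k)] [IsProbabilityMeasure ν]
    (h : ∀ g : C(X, ℝ), Filter.Tendsto (fun k : ℕ => ∫ y, g y ∂(μ k))
      Filter.atTop (nhds (∫ y, g y ∂ν)))
    {S : Type*} [Fintype S] [TopologicalSpace S] [DiscreteTopology S] {p : X → S}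
    (hp : ∀ᵐ x ∂ν, ContinuousAt p x) :
    Filter.Tendsto (fun k => partitionEntropy (μ k) p) Filter.atTop
      (nhds (partitionEntropy ν p)) := by
  let μ' : ℕ → ProbabilityMeasure X := fun k => ⟨μ k, inferInstance⟩
  let ν' : ProbabilityMeasure X := ⟨ν, inferInstance⟩
  have hlim : Filter.Tendsto μ' Filter.atTop (nhds ν') :=
    ProbabilityMeasure.tendsto_iff_forall_integral_tendsto.2 fun g => h g.toContinuousMap
  refine tendsto_finsetSum _ fun s _ => (Real.continuous_negMulLog.tendsto _).comp ?_
  refine (ENNReal.tendsto_toReal (measure_ne_top ν _)).comp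
    (ProbabilityMeasure.tendsto_measure_of_null_frontier_of_tendsto' hlim ?_)
  refine measure_eq_zero_iff_ae_notMem.2 (hp.mono fun x hx hfr => ?_)
  by_cases hs : p x = s
  · exact hfr.2 (mem_interior_iff_mem_nhds.2 (hx (by simp [hs])))
  · have hc : p ⁻¹' {s}ᶜ ∈ nhds x := hx (by simp [hs])
    obtain ⟨y, hy, hy'⟩ := mem_closure_iff_nhds.1 hfr.1 _ hc
    exact hy hy'

theorem ae_continuousAt_itinerary {X : Type*} [TopologicalSpace X] [MeasurableSpace X]
    {ν : Measure X} {f : X → X} (hf : Continuous f) (hν : MeasurePreserving f ν ν)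
    {S : Type*} [TopologicalSpace S] {p : X → S}
    (hp : ∀ᵐ x ∂ν, ContinuousAt p x) (n : ℕ) : ∀ᵐ x ∂ν, ContinuousAt (itinerary f n p) x := by
  have : ∀ᵐ x ∂ν, ∀ i : Fin n, ContinuousAt p (f^[(i : ℕ)] x) :=
    ae_all_iff.2 fun i => (hν.iterate i).quasiMeasurePreserving.ae hp
  filter_upwards [this] with x hx
  exact continuousAt_pi.2 fun i => (hx i).comp (hf.iterate i).continuousAt

end WeakConvergence

/-- for an expansive homeomorphism f of a compact metric space, the
entropy map μ ↦ h_μ(f) is upper semi-continuous on invariant Borel probability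
measures with the weak* topology: if μ_k → ν weak*, then limsup h_{μ_k}(f) ≤ h_ν(f). -/
theorem entropy_upper_semicontinuous_of_expansive {X : Type*} [MetricSpace X]
    [CompactSpace X] [MeasurableSpace X] [BorelSpace X]
    (f : X ≃ₜ X)
    (hexp : ∃ ε : ℝ, 0 < ε ∧ ∀ x y : X, x ≠ y →
      ∃ k : ℤ, ε ≤ dist (zIter f k x) (zIter f k y)) :
    ∀ (μ : ℕ → Measure X) (ν : Measure X),
      (∀ k, IsProbabilityMeasure (μ k)) → (∀ k, Measure.map (⇑f) (μ k) = μ k) →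
      IsProbabilityMeasure ν → Measure.map (⇑f) ν = ν →
      (∀ g : C(X, ℝ), Filter.Tendsto (fun k : ℕ => ∫ y, g y ∂(μ k))
        Filter.atTop (nhds (∫ y, g y ∂ν))) →
      Filter.limsup (fun k : ℕ => ksEntropy (μ k) ⇑f) Filter.atTop ≤ ksEntropy ν ⇑f := by
  intro μ ν hμ hμf hν hνf hlim
  obtain ⟨ε, hε, hexp⟩ := hexp
  obtain ⟨m, p, hp, hpd, hpc⟩ := exists_partition_dist_lt_ae_continuousAt ν (half_pos hε)
  have hμ' : ∀ k, MeasurePreserving f (μ k) (μ k) := fun k => ⟨f.continuous.measurable, hμf k⟩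
  have hν' : MeasurePreserving f ν ν := ⟨f.continuous.measurable, hνf⟩
  rw [ksEntropy_eq_entropyOfPartition_of_expansive f (half_lt_self hε) hexp hν' hp hpd]
  refine le_ciInf fun n => ?_
  have ht := (tendsto_partitionEntropy_of_ae_continuousAt hlim
    (ae_continuousAt_itinerary f.continuous hν' hpc (n + 1))).div_const ((n : ℝ) + 1)
  refine le_of_le_of_eq (Filter.limsup_le_limsup (.of_forall fun k => ?_)
    (Filter.isCoboundedUnder_le_of_le _ fun k => ksEntropy_nonneg) ht.isBoundedUnder_le)
    ht.limsup_eq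
  exact (ksEntropy_eq_entropyOfPartition_of_expansive f (half_lt_self hε) hexp (hμ' k) hp
    hpd).trans_le (entropyOfPartition_le p n)
end
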